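/- For every γ ∈ B_• and all terms t, t' ∈ T₁^{*,∘}: if the evaluations of t and t' at γ in (B_•, *, ∘) are equal, then t =_ALD t'. Equivalently, the closure of {γ} under the operations * and ∘ of B_• is a free ALD-system based on {γ}. -/

import Mathlib

namespace ParenBraid

/-- Generators of the parenthesized braid group: `Sum.inl i` stands for `σ_{i+1}` and
`Sum.inr i` stands for `a_{i+1}` (so the index `i : ℕ` ranges over `0, 1, 2, …`,
representing the indices `1, 2, 3, …` of the paper). -/
abbrev Gen : Type := ℕ ⊕ ℕ

/-- The free-group generator `σ_{i+1}`. -/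
def sg (i : ℕ) : FreeGroup Gen := FreeGroup.of (Sum.inl i)

/-- The free-group generator `a_{i+1}`. -/
def ag (i : ℕ) : FreeGroup Gen := FreeGroup.of (Sum.inr i)

/-- The defining relations of the parenthesized braid group `B_•`, written as words
`lhs * rhs⁻¹`:  `σ_jσ_i = σ_iσ_j` and `a_jσ_i = σ_i a_j` for `j ≥ i+2`;
`a_jσ_i = σ_{i+1} a_j` and `a_j a_i = a_{i+1} a_j` for `j ≤ i−1`; and
`σ_{i+1}σ_iσ_{i+1} = σ_iσ_{i+1}σ_i`, `σ_iσ_{i+1} a_i = a_{i+1}σ_i`,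
`σ_{i+1}σ_i a_{i+1} = a_iσ_i` for all `i ≥ 1`. -/
def rels : Set (FreeGroup Gen) :=
  {r | (∃ i j : ℕ, j ≥ i + 2 ∧ r = sg j * sg i * (sg i * sg j)⁻¹) ∨
       (∃ i j : ℕ, j ≥ i + 2 ∧ r = ag j * sg i * (sg i * ag j)⁻¹) ∨
       (∃ i j : ℕ, j < i ∧ r = ag j * sg i * (sg (i + 1) * ag j)⁻¹) ∨
       (∃ i j : ℕ, j < i ∧ r = ag j * ag i * (ag (i + 1) * ag j)⁻¹) ∨
       (∃ i : ℕ, r = sg (i + 1) * sg i * sg (i + 1) * (sg i * sg (i + 1) * sg i)⁻¹) ∨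
       (∃ i : ℕ, r = sg i * sg (i + 1) * ag i * (ag (i + 1) * sg i)⁻¹) ∨
       (∃ i : ℕ, r = sg (i + 1) * sg i * ag (i + 1) * (ag i * sg i)⁻¹)}

/-- The parenthesized braid group `B_•`. -/
def Bdot : Type := PresentedGroup rels

instance : Group Bdot := by unfold Bdot; infer_instance

/-- The generator `σ_{i+1}` of `B_•`. -/
def σ (i : ℕ) : Bdot := PresentedGroup.of (Sum.inl i)

/-- The generator `a_{i+1}` of `B_•`. -/
def a (i : ℕ) : Bdot := PresentedGroup.of (Sum.inr i)

/-- Terms in a single variable over the two operation symbols `*` and `∘`. -/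
inductive Term1 : Type
  | var : Term1
  | star : Term1 → Term1 → Term1
  | circ : Term1 → Term1 → Term1

/-- The smallest congruence on one-variable `{*,∘}`-terms containing all instances of
(LD) `x*(y*z) = (x*y)*(x*z)`, (ALD₁) `(x∘y)*z = x*(y*z)`,
(ALD₂) `x*(y∘z) = (x*y)∘(x*z)`. -/
inductive ALDCong : Term1 → Term1 → Prop
  | LD (t₁ t₂ t₃ : Term1) :
      ALDCong (.star t₁ (.star t₂ t₃)) (.star (.star t₁ t₂) (.star t₁ t₃))
  | ALD1 (t₁ t₂ t₃ : Term1) :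
      ALDCong (.star (.circ t₁ t₂) t₃) (.star t₁ (.star t₂ t₃))
  | ALD2 (t₁ t₂ t₃ : Term1) :
      ALDCong (.star t₁ (.circ t₂ t₃)) (.circ (.star t₁ t₂) (.star t₁ t₃))
  | refl (t : Term1) : ALDCong t t
  | symm {s t : Term1} : ALDCong s t → ALDCong t s
  | trans {s t u : Term1} : ALDCong s t → ALDCong t u → ALDCong s u
  | starCong {s s' t t' : Term1} : ALDCong s s' → ALDCong t t' →
      ALDCong (.star s t) (.star s' t')
  | circCong {s s' t t' : Term1} : ALDCong s s' → ALDCong t t' →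
      ALDCong (.circ s t) (.circ s' t')

/-- The evaluation `t(γ)` of a `{*,∘}`-term `t` at `γ` in `(B_•, *, ∘)`, where
`β * γ := β·∂γ·σ₁·(∂β)⁻¹` and `β ∘ γ := β·∂γ·a₁`. -/
def evalT (D : Bdot →* Bdot) (γ : Bdot) : Term1 → Bdot
  | .var => γ
  | .star u v => evalT D γ u * D (evalT D γ v) * σ 0 * (D (evalT D γ u))⁻¹
  | .circ u v => evalT D γ u * D (evalT D γ v) * a 0

/-! ### Relations and homomorphisms out of `B_•` -/

theorem σ_comm {i j : ℕ} (h : i + 2 ≤ j) : σ j * σ i = σ i * σ j :=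
  PresentedGroup.mk_eq_mk_of_mul_inv_mem (rels := rels) (Or.inl ⟨i, j, h, rfl⟩)

theorem a_σ_far {i j : ℕ} (h : i + 2 ≤ j) : a j * σ i = σ i * a j :=
  PresentedGroup.mk_eq_mk_of_mul_inv_mem (rels := rels) (Or.inr (Or.inl ⟨i, j, h, rfl⟩))

theorem a_σ_shift {i j : ℕ} (h : j < i) : a j * σ i = σ (i + 1) * a j :=
  PresentedGroup.mk_eq_mk_of_mul_inv_mem (rels := rels)
    (Or.inr (Or.inr (Or.inl ⟨i, j, h, rfl⟩)))

theorem a_a_shift {i j : ℕ} (h : j < i) : a j * a i = a (i + 1) * a j :=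
  PresentedGroup.mk_eq_mk_of_mul_inv_mem (rels := rels)
    (Or.inr (Or.inr (Or.inr (Or.inl ⟨i, j, h, rfl⟩))))

theorem σ_braid (i : ℕ) : σ (i + 1) * σ i * σ (i + 1) = σ i * σ (i + 1) * σ i :=
  PresentedGroup.mk_eq_mk_of_mul_inv_mem (rels := rels)
    (Or.inr (Or.inr (Or.inr (Or.inr (Or.inl ⟨i, rfl⟩)))))

theorem σ_σ_a (i : ℕ) : σ i * σ (i + 1) * a i = a (i + 1) * σ i :=
  PresentedGroup.mk_eq_mk_of_mul_inv_mem (rels := rels)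
    (Or.inr (Or.inr (Or.inr (Or.inr (Or.inr (Or.inl ⟨i, rfl⟩))))))

theorem σ_σ_a_succ (i : ℕ) : σ (i + 1) * σ i * a (i + 1) = a i * σ i :=
  PresentedGroup.mk_eq_mk_of_mul_inv_mem (rels := rels)
    (Or.inr (Or.inr (Or.inr (Or.inr (Or.inr (Or.inr ⟨i, rfl⟩))))))

/-- The homomorphism from `B_•` to a group with two sequences of elements satisfying the
defining relations of `B_•`. -/
def Bdot.lift {G : Type*} [Group G] (s t : ℕ → G)
    (h₁ : ∀ i j, i + 2 ≤ j → s j * s i = s i * s j)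
    (h₂ : ∀ i j, i + 2 ≤ j → t j * s i = s i * t j)
    (h₃ : ∀ i j, j < i → t j * s i = s (i + 1) * t j)
    (h₄ : ∀ i j, j < i → t j * t i = t (i + 1) * t j)
    (h₅ : ∀ i, s (i + 1) * s i * s (i + 1) = s i * s (i + 1) * s i)
    (h₆ : ∀ i, s i * s (i + 1) * t i = t (i + 1) * s i)
    (h₇ : ∀ i, s (i + 1) * s i * t (i + 1) = t i * s i) : Bdot →* G :=
  PresentedGroup.toGroup (rels := rels) (f := Sum.elim s t) <| by
    rintro r (⟨i, j, h, rfl⟩ | ⟨i, j, h, rfl⟩ | ⟨i, j, h, rfl⟩ | ⟨i, j, h, rfl⟩ | ⟨i, rfl⟩ |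
      ⟨i, rfl⟩ | ⟨i, rfl⟩) <;>
    simp only [sg, ag, map_mul, map_inv, FreeGroup.lift_apply_of, Sum.elim_inl, Sum.elim_inr,
      mul_inv_eq_one]
    exacts [h₁ i j h, h₂ i j h, h₃ i j h, h₄ i j h, h₅ i, h₆ i, h₇ i]

section
variable {G : Type*} [Group G] {s t : ℕ → G} {h₁ : ∀ i j, i + 2 ≤ j → s j * s i = s i * s j}
    {h₂ : ∀ i j, i + 2 ≤ j → t j * s i = s i * t j}
    {h₃ : ∀ i j, j < i → t j * s i = s (i + 1) * t j}
    {h₄ : ∀ i j, j < i → t j * t i = t (i + 1) * t j}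
    {h₅ : ∀ i, s (i + 1) * s i * s (i + 1) = s i * s (i + 1) * s i}
    {h₆ : ∀ i, s i * s (i + 1) * t i = t (i + 1) * s i}
    {h₇ : ∀ i, s (i + 1) * s i * t (i + 1) = t i * s i}

theorem Bdot.lift_σ (i : ℕ) : Bdot.lift s t h₁ h₂ h₃ h₄ h₅ h₆ h₇ (σ i) = s i :=
  PresentedGroup.toGroup.of _

theorem Bdot.lift_a (i : ℕ) : Bdot.lift s t h₁ h₂ h₃ h₄ h₅ h₆ h₇ (a i) = t i :=
  PresentedGroup.toGroup.of _
end

theorem Bdot.induction {C : Bdot → Prop} (z : Bdot) (one : C 1) (hσ : ∀ i, C (σ i))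
    (ha : ∀ i, C (a i)) (inv : ∀ x, C x → C x⁻¹) (mul : ∀ x y, C x → C y → C (x * y)) : C z := by
  refine PresentedGroup.induction_on (rels := rels) z fun w => ?_
  induction w using FreeGroup.induction_on with
  | C1 => exact one
  | of x => exact x.casesOn hσ ha
  | inv_of x h => exact inv _ h
  | mul x y hx hy => exact mul _ _ hx hy

/-! ### Injectivity of the shift -/

/-- The exponent sum of the letters `a_i`. -/
def aDegree : Bdot →* Multiplicative ℤ :=
  Bdot.lift (fun _ => 1) (fun _ => Multiplicative.ofAdd 1) (by simp) (by simp) (by simp) (by simp)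
    (by simp) (by simp) (by simp)

theorem aDegree_σ (i : ℕ) : aDegree (σ i) = 1 := Bdot.lift_σ i

theorem aDegree_a (i : ℕ) : aDegree (a i) = Multiplicative.ofAdd 1 := Bdot.lift_a i

/-- The product `σ₁σ₂⋯σ_m`. -/
def σProd : ℕ → Bdot
  | 0 => 1
  | m + 1 => σProd m * σ m

theorem σ_mul_σProd {m j : ℕ} (h : m < j) : σ j * σProd m = σProd m * σ j := by
  induction m with
  | zero => simp [σProd]
  | succ m ih =>
    rw [σProd, ← mul_assoc, ih (by omega), mul_assoc, σ_comm (by omega), mul_assoc]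

theorem a_mul_σProd {m j : ℕ} (h : m < j) : a j * σProd m = σProd m * a j := by
  induction m with
  | zero => simp [σProd]
  | succ m ih =>
    rw [σProd, ← mul_assoc, ih (by omega), mul_assoc, a_σ_far (by omega), mul_assoc]

theorem σ_succ_mul_σProd {m i : ℕ} (h : i + 2 ≤ m) : σ (i + 1) * σProd m = σProd m * σ i := by
  induction m, h using Nat.le_induction with
  | base =>
    simp only [σProd]
    rw [← mul_assoc, ← mul_assoc, σ_mul_σProd (Nat.lt_succ_self i), mul_assoc, mul_assoc,
      ← mul_assoc (σ (i + 1)), σ_braid]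
    simp only [mul_assoc]
  | succ m hm ih => rw [σProd, ← mul_assoc, ih, mul_assoc, mul_assoc, σ_comm hm]

theorem a_succ_mul_σProd {m i : ℕ} (h : i + 1 ≤ m) :
    a (i + 1) * σProd m = σProd (m + 1) * a i := by
  induction m, h using Nat.le_induction with
  | base =>
    simp only [σProd]
    rw [← mul_assoc, a_mul_σProd (Nat.lt_succ_self i), mul_assoc, ← σ_σ_a]
    simp only [mul_assoc]
  | succ m hm ih =>
    rw [σProd, ← mul_assoc, ih, mul_assoc, a_σ_shift hm, ← mul_assoc]
    rfl

theorem exists_shift_mul_σProd {D : Bdot →* Bdot} (hDσ : ∀ i : ℕ, D (σ i) = σ (i + 1))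
    (hDa : ∀ i : ℕ, D (a i) = a (i + 1)) (z : Bdot) : ∃ N : ℕ, ∀ m n : ℕ, N ≤ m →
    (n : ℤ) = m + (aDegree z).toAdd → D z * σProd m = σProd n * z := by
  induction z using Bdot.induction with
  | one =>
    refine ⟨0, fun m n _ h => ?_⟩
    obtain rfl : n = m := by simpa using h
    simp
  | hσ i =>
    refine ⟨i + 2, fun m n hm h => ?_⟩
    obtain rfl : n = m := by simpa [aDegree_σ] using h
    rw [hDσ, σ_succ_mul_σProd hm]
  | ha i =>
    refine ⟨i + 1, fun m n hm h => ?_⟩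
    obtain rfl : n = m + 1 := by simp [aDegree_a] at h; omega
    rw [hDa, a_succ_mul_σProd hm]
  | inv x ih =>
    obtain ⟨N, hN⟩ := ih
    refine ⟨N + (aDegree x).toAdd.natAbs, fun m n hm h => ?_⟩
    rw [map_inv, toAdd_inv] at h
    rw [map_inv, inv_mul_eq_iff_eq_mul, ← mul_assoc, hN n m (by omega) (by omega)]
    simp
  | mul x y hx hy =>
    obtain ⟨N, hN⟩ := hx
    obtain ⟨M, hM⟩ := hy
    refine ⟨M + N + (aDegree y).toAdd.natAbs, fun m n hm h => ?_⟩
    rw [map_mul, toAdd_mul] at h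
    obtain ⟨k, hk⟩ := Int.eq_ofNat_of_zero_le (a := m + (aDegree y).toAdd) (by omega)
    rw [map_mul, mul_assoc, hM m k (by omega) (by omega), ← mul_assoc,
      hN k n (by omega) (by omega), mul_assoc]

theorem shift_injective {D : Bdot →* Bdot} (hDσ : ∀ i : ℕ, D (σ i) = σ (i + 1))
    (hDa : ∀ i : ℕ, D (a i) = a (i + 1)) : Function.Injective D := by
  rw [injective_iff_map_eq_one]
  intro z hz
  have hd : aDegree z = aDegree (D z) := by
    clear hz
    induction z using Bdot.induction with
    | one => simp
    | hσ i => simp [hDσ, aDegree_σ]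
    | ha i => simp [hDa, aDegree_a]
    | inv x ih => simp [ih]
    | mul x y hx hy => simp [hx, hy]
  rw [hz, map_one] at hd
  obtain ⟨N, hN⟩ := exists_shift_mul_σProd hDσ hDa z
  simpa [hz] using hN N N le_rfl (by simp [hd])

/-! ### The Artin representation of `B_•` -/

/-- The free group on which `B_•` acts: the letter `(i, q)` is the loop around the initial segment
ending at `q` of the `i`-th strand, viewed as a cable; `q = 0` codes the whole strand. -/
abbrev LoopGroup : Type := FreeGroup (ℕ × ℕ)

/-- The generator `(i, q)` of `LoopGroup`. -/
abbrev loop (i q : ℕ) : LoopGroup := FreeGroup.of (i, q)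

/-- The image under the action of `σ_i` of a generator. -/
def braidLetter (i : ℕ) (p : ℕ × ℕ) : LoopGroup :=
  if p.1 = i then loop i 0 * loop (i + 1) p.2 * (loop i 0)⁻¹
  else if p.1 = i + 1 then loop i p.2 else loop p.1 p.2

/-- The image under the action of `σ_i⁻¹` of a generator. -/
def braidInvLetter (i : ℕ) (p : ℕ × ℕ) : LoopGroup :=
  if p.1 = i then loop (i + 1) p.2
  else if p.1 = i + 1 then (loop (i + 1) 0)⁻¹ * loop i p.2 * loop (i + 1) 0 else loop p.1 p.2

/-- The image under the action of `a_i` of a generator. -/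
def splitLetter (i : ℕ) (p : ℕ × ℕ) : LoopGroup :=
  if p.1 < i then loop p.1 p.2
  else if p.1 = i then
    if p.2 % 2 = 0 then loop i 0 * loop (i + 1) (p.2 / 2) else loop i (p.2 / 2)
  else loop (p.1 + 1) p.2

/-- The image under the action of `a_i⁻¹` of a generator. -/
def splitInvLetter (i : ℕ) (p : ℕ × ℕ) : LoopGroup :=
  if p.1 < i then loop p.1 p.2
  else if p.1 = i then loop i (2 * p.2 + 1)
  else if p.1 = i + 1 then (loop i 1)⁻¹ * loop i (2 * p.2) else loop (p.1 - 1) p.2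

/-- The action of `σ_i` on `LoopGroup`. -/
def braidAut (i : ℕ) : MulAut LoopGroup :=
  MonoidHom.toMulEquiv (FreeGroup.lift (braidLetter i)) (FreeGroup.lift (braidInvLetter i))
    (by
      ext ⟨j, q⟩
      rcases eq_or_ne j i with rfl | h₁
      · simp [braidLetter, braidInvLetter, mul_assoc]
      rcases eq_or_ne j (i + 1) with rfl | h₂
      · simp [braidLetter, braidInvLetter]
      · simp [braidLetter, braidInvLetter, h₁, h₂])
    (by
      ext ⟨j, q⟩
      rcases eq_or_ne j i with rfl | h₁
      · simp [braidLetter, braidInvLetter]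
      rcases eq_or_ne j (i + 1) with rfl | h₂
      · simp [braidLetter, braidInvLetter, mul_assoc]
      · simp [braidLetter, braidInvLetter, h₁, h₂])

/-- The action of `a_i` on `LoopGroup`. -/
def splitAut (i : ℕ) : MulAut LoopGroup :=
  MonoidHom.toMulEquiv (FreeGroup.lift (splitLetter i)) (FreeGroup.lift (splitInvLetter i))
    (by
      ext ⟨j, q⟩
      rcases lt_trichotomy j i with h | rfl | h
      · simp [splitLetter, splitInvLetter, h]
      · obtain ⟨k, rfl | rfl⟩ := Nat.even_or_odd' q
        · simp [splitLetter, splitInvLetter]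
        · simp [splitLetter, splitInvLetter, Nat.add_mod, show (2 * k + 1) / 2 = k by omega]
      · simp [splitLetter, splitInvLetter, show ¬ j < i by omega, show j ≠ i by omega,
          show ¬ j + 1 < i by omega, show j + 1 ≠ i by omega])
    (by
      ext ⟨j, q⟩
      rcases lt_trichotomy j i with h | rfl | h
      · simp [splitLetter, splitInvLetter, h]
      · simp [splitLetter, splitInvLetter, Nat.add_mod, show (2 * q + 1) / 2 = q by omega]
      rcases eq_or_ne j (i + 1) with rfl | h₂
      · simp [splitLetter, splitInvLetter]
      · simp [splitLetter, splitInvLetter, show ¬ j < i by omega, show j ≠ i by omega, h₂,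
          show ¬ j - 1 < i by omega, show j - 1 ≠ i by omega, show j - 1 + 1 = j by omega])

theorem braidAut_loop (i j q : ℕ) : braidAut i (loop j q) = braidLetter i (j, q) :=
  FreeGroup.lift_apply_of

theorem splitAut_loop (i j q : ℕ) : splitAut i (loop j q) = splitLetter i (j, q) :=
  FreeGroup.lift_apply_of

theorem braidAut_loop_of_ne {i j : ℕ} (q : ℕ) (h : j ≠ i) (h' : j ≠ i + 1) :
    braidAut i (loop j q) = loop j q := by
  simp [braidAut_loop, braidLetter, h, h']

theorem splitAut_loop_of_lt {i j : ℕ} (q : ℕ) (h : j < i) :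
    splitAut i (loop j q) = loop j q := by
  simp [splitAut_loop, splitLetter, h]

theorem splitAut_loop_even (i k : ℕ) :
    splitAut i (loop i (2 * k)) = loop i 0 * loop (i + 1) k := by
  simp [splitAut_loop, splitLetter]

theorem splitAut_loop_odd (i k : ℕ) : splitAut i (loop i (2 * k + 1)) = loop i k := by
  simp [splitAut_loop, splitLetter, Nat.add_mod, show (2 * k + 1) / 2 = k by omega]

theorem loopAut_ext {φ ψ : MulAut LoopGroup} (h : ∀ j q, φ (loop j q) = ψ (loop j q)) : φ = ψ :=
  MulEquiv.toMonoidHom_injective (FreeGroup.ext_hom _ _ fun p => h p.1 p.2)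

theorem braidAut_comm {i j : ℕ} (h : i + 2 ≤ j) :
    braidAut j * braidAut i = braidAut i * braidAut j := by
  refine loopAut_ext fun k q => ?_
  simp only [MulAut.mul_apply, braidAut_loop, braidLetter]
  split_ifs <;> simp only [map_mul, map_inv, braidAut_loop, braidLetter] <;> grind

theorem splitAut_braidAut_far {i j : ℕ} (h : i + 2 ≤ j) :
    splitAut j * braidAut i = braidAut i * splitAut j := by
  refine loopAut_ext fun k q => ?_
  simp only [MulAut.mul_apply, braidAut_loop, braidLetter, splitAut_loop, splitLetter]
  split_ifs <;>
    simp only [map_mul, map_inv, braidAut_loop, braidLetter, splitAut_loop, splitLetter] <;> grind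

theorem splitAut_braidAut_shift {i j : ℕ} (h : j < i) :
    splitAut j * braidAut i = braidAut (i + 1) * splitAut j := by
  refine loopAut_ext fun k q => ?_
  simp only [MulAut.mul_apply, braidAut_loop, braidLetter, splitAut_loop, splitLetter]
  split_ifs <;>
    simp only [map_mul, map_inv, braidAut_loop, braidLetter, splitAut_loop, splitLetter] <;> grind

theorem splitAut_splitAut_shift {i j : ℕ} (h : j < i) :
    splitAut j * splitAut i = splitAut (i + 1) * splitAut j := by
  refine loopAut_ext fun k q => ?_
  simp only [MulAut.mul_apply, splitAut_loop, splitLetter]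
  split_ifs <;> simp only [map_mul, splitAut_loop, splitLetter] <;> grind

theorem braidAut_braid (i : ℕ) :
    braidAut (i + 1) * braidAut i * braidAut (i + 1) =
      braidAut i * braidAut (i + 1) * braidAut i := by
  refine loopAut_ext fun k q => ?_
  have hn : ∀ n : ℕ, n ≠ n + 1 + 1 := by omega
  have hn' : ∀ n : ℕ, n + 1 + 1 ≠ n := by omega
  have h : k = i ∨ k = i + 1 ∨ k = i + 2 ∨ (k ≠ i ∧ k ≠ i + 1 ∧ k ≠ i + 2) := by omega
  rcases h with rfl | rfl | rfl | ⟨h₀, h₁, h₂⟩ <;>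
    simp [braidAut_loop, braidLetter, mul_assoc, *]

theorem braidAut_braidAut_splitAut (i : ℕ) :
    braidAut i * braidAut (i + 1) * splitAut i = splitAut (i + 1) * braidAut i := by
  refine loopAut_ext fun k q => ?_
  have hn : ∀ n : ℕ, n ≠ n + 1 + 1 := by omega
  have hn' : ∀ n : ℕ, n + 1 + 1 ≠ n := by omega
  have h : k < i ∨ k = i ∨ k = i + 1 ∨ i + 2 ≤ k := by omega
  rcases h with h | rfl | rfl | h
  · simp [braidAut_loop, braidLetter, splitAut_loop, splitLetter, h, h.ne,
      show k < i + 1 by omega, show k ≠ i + 1 by omega, show k ≠ i + 2 by omega]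
  · obtain ⟨n, rfl | rfl⟩ := Nat.even_or_odd' q <;>
      simp [braidAut_loop, braidLetter, splitAut_loop, splitLetter, mul_assoc, hn, hn', Nat.add_mod,
        show (2 * n + 1) / 2 = n by omega]
  · simp [braidAut_loop, braidLetter, splitAut_loop, splitLetter]
  · simp [braidAut_loop, braidLetter, splitAut_loop, splitLetter, show ¬ k < i by omega,
      show ¬ k < i + 1 by omega, show k ≠ i by omega, show k ≠ i + 1 by omega,
      show k + 1 ≠ i by omega]

theorem braidAut_braidAut_splitAut_succ (i : ℕ) :
    braidAut (i + 1) * braidAut i * splitAut (i + 1) = splitAut i * braidAut i := by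
  refine loopAut_ext fun k q => ?_
  have hn : ∀ n : ℕ, n ≠ n + 1 + 1 := by omega
  have hn' : ∀ n : ℕ, n + 1 + 1 ≠ n := by omega
  have h : k < i ∨ k = i ∨ k = i + 1 ∨ i + 2 ≤ k := by omega
  rcases h with h | rfl | rfl | h
  · simp [braidAut_loop, braidLetter, splitAut_loop, splitLetter, h, h.ne,
      show k < i + 1 by omega, show k ≠ i + 1 by omega, show k ≠ i + 2 by omega]
  · simp [braidAut_loop, braidLetter, splitAut_loop, splitLetter, mul_assoc, hn]
  · obtain ⟨n, rfl | rfl⟩ := Nat.even_or_odd' q <;>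
      simp [braidAut_loop, braidLetter, splitAut_loop, splitLetter, mul_assoc, hn, hn', Nat.add_mod,
        show (2 * n + 1) / 2 = n by omega]
  · simp [braidAut_loop, braidLetter, splitAut_loop, splitLetter, show ¬ k < i by omega,
      show ¬ k < i + 1 by omega, show k ≠ i by omega, show k ≠ i + 1 by omega,
      show k + 1 ≠ i by omega]

/-- The Artin representation of `B_•`. -/
def artin : Bdot →* MulAut LoopGroup :=
  Bdot.lift braidAut splitAut (fun _ _ => braidAut_comm) (fun _ _ => splitAut_braidAut_far)
    (fun _ _ => splitAut_braidAut_shift) (fun _ _ => splitAut_splitAut_shift) braidAut_braid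
    braidAut_braidAut_splitAut braidAut_braidAut_splitAut_succ

theorem artin_σ (i : ℕ) : artin (σ i) = braidAut i := Bdot.lift_σ i

theorem artin_a (i : ℕ) : artin (a i) = splitAut i := Bdot.lift_a i

/-- The endomorphism of `LoopGroup` adding an unused strand on the left. -/
def shiftLoop : LoopGroup →* LoopGroup := FreeGroup.map fun p => (p.1 + 1, p.2)

theorem shiftLoop_loop (i q : ℕ) : shiftLoop (loop i q) = loop (i + 1) q := FreeGroup.map.of

theorem artin_shift_loop_zero {D : Bdot →* Bdot} (hDσ : ∀ i : ℕ, D (σ i) = σ (i + 1))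
    (hDa : ∀ i : ℕ, D (a i) = a (i + 1)) (g : Bdot) (q : ℕ) :
    artin (D g) (loop 0 q) = loop 0 q := by
  induction g using Bdot.induction with
  | one => simp
  | hσ i => rw [hDσ, artin_σ, braidAut_loop_of_ne q (by omega) (by omega)]
  | ha i => rw [hDa, artin_a, splitAut_loop_of_lt q (by omega)]
  | inv x ih => rw [map_inv, map_inv, MulAut.inv_apply, MulEquiv.symm_apply_eq, ih]
  | mul x y hx hy => rw [map_mul, map_mul, MulAut.mul_apply, hy, hx]

theorem artin_shift_shiftLoop {D : Bdot →* Bdot} (hDσ : ∀ i : ℕ, D (σ i) = σ (i + 1))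
    (hDa : ∀ i : ℕ, D (a i) = a (i + 1)) (g : Bdot) (w : LoopGroup) :
    artin (D g) (shiftLoop w) = shiftLoop (artin g w) := by
  have key : ∀ φ ψ : MulAut LoopGroup,
      (∀ i q, φ (loop (i + 1) q) = shiftLoop (ψ (loop i q))) →
      ∀ w, φ (shiftLoop w) = shiftLoop (ψ w) := by
    intro φ ψ h w
    refine DFunLike.congr_fun (f := φ.toMonoidHom.comp shiftLoop)
      (g := shiftLoop.comp ψ.toMonoidHom) (FreeGroup.ext_hom _ _ fun p => ?_) w
    change φ (shiftLoop (loop p.1 p.2)) = shiftLoop (ψ (loop p.1 p.2))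
    rw [shiftLoop_loop, h]
  induction g using Bdot.induction generalizing w with
  | one => simp
  | hσ i =>
    rw [hDσ, artin_σ, artin_σ]
    refine key _ _ (fun j q => ?_) w
    simp only [braidAut_loop, braidLetter, Nat.add_right_cancel_iff]
    split_ifs <;> simp [shiftLoop_loop]
  | ha i =>
    rw [hDa, artin_a, artin_a]
    refine key _ _ (fun j q => ?_) w
    simp only [splitAut_loop, splitLetter, Nat.add_right_cancel_iff, Nat.add_lt_add_iff_right]
    split_ifs <;> simp [shiftLoop_loop]
  | inv x ih =>
    rw [map_inv, map_inv, map_inv, MulAut.inv_apply, MulAut.inv_apply, MulEquiv.symm_apply_eq,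
      ih, MulEquiv.apply_symm_apply]
  | mul x y hx hy => simp only [map_mul, MulAut.mul_apply, hy, hx]

/-- Every power of `a₁` maps the loop around some cable segment of the first strand to another
such loop. -/
theorem exists_artin_zpow_loop (n : ℤ) :
    ∃ p q : ℕ, artin (a 0 ^ n) (loop 0 p) = loop 0 q ∧ (n ≠ 0 → p ≠ q) := by
  have key : ∀ m : ℕ, ∃ q : ℕ, artin (a 0 ^ m) (loop 0 q) = loop 0 0 ∧ (m ≠ 0 → q ≠ 0) := by
    intro m
    induction m with
    | zero => exact ⟨0, by simp⟩
    | succ m ih =>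
      obtain ⟨q, hq, -⟩ := ih
      refine ⟨2 * q + 1, ?_, by simp⟩
      rw [pow_succ, map_mul, MulAut.mul_apply, artin_a, splitAut_loop_odd, hq]
  obtain ⟨m, rfl | rfl⟩ := n.eq_nat_or_neg
  · obtain ⟨q, hq, h⟩ := key m
    exact ⟨q, 0, by simpa using hq, by simpa using h⟩
  · obtain ⟨q, hq, h⟩ := key m
    refine ⟨0, q, ?_, fun hm => (h (by simpa using hm)).symm⟩
    rw [zpow_neg, map_inv, MulAut.inv_apply, MulEquiv.symm_apply_eq, zpow_natCast, hq]

/-! ### Elements of the loop group starting on the first strand -/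

/-- The reduced word of `g` starts with the letter `(0, q)` if `b` is true, and with its inverse
otherwise. -/
def StartsWith (q : ℕ) (b : Bool) (g : LoopGroup) : Prop :=
  ∃ M, FreeGroup.IsReduced (((0, q), b) :: M) ∧ g = FreeGroup.mk (((0, q), b) :: M)

/-- Shift of a letter of `LoopGroup`. -/
def shiftSign (x : (ℕ × ℕ) × Bool) : (ℕ × ℕ) × Bool := ((x.1.1 + 1, x.1.2), x.2)

theorem shiftLoop_mk (W : List ((ℕ × ℕ) × Bool)) :
    shiftLoop (FreeGroup.mk W) = FreeGroup.mk (W.map shiftSign) := rfl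

/-- Normal forms for the free product decomposition of `LoopGroup` separating the first strand
from the others, for elements starting on the first strand. -/
inductive AlternatingForm : ℕ → Bool → LoopGroup → Prop
  | last (q : ℕ) (b : Bool) (u : LoopGroup) :
      AlternatingForm q b (FreeGroup.mk [((0, q), b)] * shiftLoop u)
  | cons (q : ℕ) (b : Bool) (u : LoopGroup) (q' : ℕ) (b' : Bool) (g : LoopGroup) :
      AlternatingForm q' b' g → (u = 1 → q = q' → b = b') →
      AlternatingForm q b (FreeGroup.mk [((0, q), b)] * shiftLoop u * g)

theorem AlternatingForm.map {φ ψ : MulAut LoopGroup} (h₀ : ∀ q, φ (loop 0 q) = loop 0 q)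
    (hs : ∀ w, φ (shiftLoop w) = shiftLoop (ψ w)) {q : ℕ} {b : Bool} {g : LoopGroup}
    (h : AlternatingForm q b g) : AlternatingForm q b (φ g) := by
  have hl : ∀ q b, φ (FreeGroup.mk [((0, q), b)]) = FreeGroup.mk [((0, q), b)] := by
    rintro q (_ | _)
    · exact (map_inv φ (loop 0 q)).trans (congrArg _ (h₀ q))
    · exact h₀ q
  induction h with
  | last q b u =>
    rw [map_mul, hl, hs]
    exact .last q b _
  | cons q b u q' b' g _ hu ih =>
    rw [map_mul, map_mul, hl, hs]
    exact .cons q b _ q' b' _ ih fun h => hu ((map_eq_one_iff ψ ψ.injective).1 h)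

theorem isReduced_map_shiftSign {W : List ((ℕ × ℕ) × Bool)} (h : FreeGroup.IsReduced W) :
    FreeGroup.IsReduced (W.map shiftSign) := by
  refine (List.isChain_map shiftSign).2 (List.IsChain.imp ?_ h)
  rintro ⟨⟨i, q⟩, b⟩ ⟨⟨j, r⟩, c⟩ h
  simpa [shiftSign] using h

theorem isReduced_of_map_shiftSign {W : List ((ℕ × ℕ) × Bool)}
    (h : FreeGroup.IsReduced (W.map shiftSign)) : FreeGroup.IsReduced W := by
  refine List.IsChain.imp ?_ ((List.isChain_map shiftSign).1 h)
  rintro ⟨⟨i, q⟩, b⟩ ⟨⟨j, r⟩, c⟩ h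
  simpa [shiftSign] using h

theorem AlternatingForm.startsWith {q : ℕ} {b : Bool} {g : LoopGroup}
    (h : AlternatingForm q b g) : StartsWith q b g := by
  induction h with
  | last q b u =>
    refine ⟨u.toWord.map shiftSign, ?_, ?_⟩
    · refine List.isChain_cons.2 ⟨?_, isReduced_map_shiftSign FreeGroup.isReduced_toWord⟩
      intro y hy
      cases hW : u.toWord with
      | nil => simp [hW] at hy
      | cons x W =>
        rw [hW] at hy
        obtain rfl : shiftSign x = y := by simpa using hy
        simp [shiftSign]
    · conv_lhs => rw [← u.mk_toWord, shiftLoop_mk, FreeGroup.mul_mk, List.singleton_append]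
  | cons q b u q' b' g _ hu ih =>
    obtain ⟨M, hM, rfl⟩ := ih
    refine ⟨u.toWord.map shiftSign ++ ((0, q'), b') :: M, ?_, ?_⟩
    · cases hW : u.toWord with
      | nil =>
        have hu1 : u = 1 := FreeGroup.toWord_eq_nil_iff.1 hW
        refine List.isChain_cons_cons.2 ⟨?_, hM⟩
        intro h
        exact hu hu1 (by simpa using h)
      | cons x W =>
        have hr : FreeGroup.IsReduced (x :: W) := hW ▸ FreeGroup.isReduced_toWord
        refine List.isChain_cons_cons.2 ⟨by simp [shiftSign], ?_⟩
        refine List.IsChain.append (isReduced_map_shiftSign hr) hM ?_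
        intro y hy z hz
        obtain rfl : ((0, q'), b') = z := by simpa using hz
        obtain ⟨y, -, rfl⟩ := List.mem_map.1 (List.mem_of_getLast? hy)
        simp [shiftSign]
    · conv_lhs => rw [← u.mk_toWord, shiftLoop_mk, FreeGroup.mul_mk, FreeGroup.mul_mk,
        List.singleton_append, List.cons_append]

theorem exists_shiftSign_append (M : List ((ℕ × ℕ) × Bool)) :
    ∃ W R : List ((ℕ × ℕ) × Bool), M = W.map shiftSign ++ R ∧
      (R = [] ∨ ∃ q b R', R = ((0, q), b) :: R') := by
  induction M with
  | nil => exact ⟨[], [], rfl, Or.inl rfl⟩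
  | cons x M ih =>
    obtain ⟨⟨i, q⟩, b⟩ := x
    cases i with
    | zero => exact ⟨[], _, rfl, Or.inr ⟨q, b, M, rfl⟩⟩
    | succ i =>
      obtain ⟨W, R, rfl, hR⟩ := ih
      exact ⟨((i, q), b) :: W, R, rfl, hR⟩

theorem StartsWith.alternatingForm {q : ℕ} {b : Bool} {g : LoopGroup}
    (h : StartsWith q b g) : AlternatingForm q b g := by
  obtain ⟨M, hM, rfl⟩ := h
  induction hn : M.length using Nat.strong_induction_on generalizing q b M with
  | _ n ih =>
    subst hn
    obtain ⟨W, R, rfl, rfl | ⟨q', b', R, rfl⟩⟩ := exists_shiftSign_append M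
    · have := AlternatingForm.last q b (FreeGroup.mk W)
      rwa [shiftLoop_mk, FreeGroup.mul_mk, List.singleton_append,
        ← List.append_nil (W.map _)] at this
    · have hr := List.isChain_append.1 (List.isChain_cons.1 hM).2
      have hg := ih R.length (by simp; omega) R hr.2.1 rfl
      have := AlternatingForm.cons q b (FreeGroup.mk W) q' b' _ hg ?_
      · rwa [shiftLoop_mk, FreeGroup.mul_mk, FreeGroup.mul_mk, List.singleton_append,
          List.cons_append] at this
      · intro h hq
        have hW : W = [] := by
          rw [← (isReduced_of_map_shiftSign hr.1).reduce_eq, ← FreeGroup.toWord_mk, h,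
            FreeGroup.toWord_one]
        subst hW
        exact (List.isChain_cons_cons.1 hM).1 (by simp [hq])

theorem StartsWith.artin_shift {D : Bdot →* Bdot} (hDσ : ∀ i : ℕ, D (σ i) = σ (i + 1))
    (hDa : ∀ i : ℕ, D (a i) = a (i + 1)) (x : Bdot) {q : ℕ} {b : Bool} {g : LoopGroup}
    (h : StartsWith q b g) : StartsWith q b (artin (D x) g) :=
  (h.alternatingForm.map (artin_shift_loop_zero hDσ hDa x)
    (artin_shift_shiftLoop hDσ hDa x)).startsWith

/-- Constraints on a reduced word representing the image under the action of `σ₁` of an element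
whose reduced word starts with the given letter. -/
def BraidImage : (ℕ × ℕ) × Bool → List ((ℕ × ℕ) × Bool) → Prop
  | ((0, q), b), M => ∃ M', M = ((0, 0), true) :: ((1, q), b) :: M'
  | ((1, 0), false), M => (∃ M', M = ((0, 0), false) :: M') ∨ ∃ r c M', M = ((1, r), c) :: M'
  | ((1, 0), true), M => ∃ M', M = ((0, 0), true) :: M' ∧ ∀ x ∈ M'.head?, x.1.1 ≠ 1
  | ((1, q + 1), b), M => ∃ M', M = ((0, q + 1), b) :: M'
  | ((j + 2, q), b), M => ∃ M', M = ((j + 2, q), b) :: M'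

theorem mk_cons_cancel (p : ℕ × ℕ) (b : Bool) (M : List ((ℕ × ℕ) × Bool)) :
    FreeGroup.mk ((p, b) :: (p, !b) :: M) = FreeGroup.mk M :=
  Quot.sound FreeGroup.Red.Step.cons_not

theorem isReduced_cons_iff {x : (ℕ × ℕ) × Bool} {M : List ((ℕ × ℕ) × Bool)} :
    FreeGroup.IsReduced (x :: M) ↔
      (∀ y ∈ M.head?, x.1 = y.1 → x.2 = y.2) ∧ FreeGroup.IsReduced M := List.isChain_cons

theorem braidAut_mk_singleton (x : (ℕ × ℕ) × Bool) : braidAut 0 (FreeGroup.mk [x]) =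
    FreeGroup.mk (if x.1.1 = 0 then [((0, 0), true), ((1, x.1.2), x.2), ((0, 0), false)]
      else if x.1.1 = 1 then [((0, x.1.2), x.2)] else [x]) := by
  obtain ⟨⟨j, q⟩, b⟩ := x
  have key : braidAut 0 (loop j q) = FreeGroup.mk (
      if j = 0 then [((0, 0), true), ((1, q), true), ((0, 0), false)]
      else if j = 1 then [((0, q), true)] else [((j, q), true)]) := by
    rw [braidAut_loop]
    unfold braidLetter
    split_ifs <;> rfl
  cases b
  · refine (map_inv (braidAut 0) (loop j q)).trans ?_
    rw [key, FreeGroup.inv_mk]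
    split_ifs <;> rfl
  · refine Eq.trans key ?_
    rfl

theorem braidImage_cons {x : (ℕ × ℕ) × Bool} {M : List ((ℕ × ℕ) × Bool)}
    (hM : FreeGroup.IsReduced M)
    (h : M = [] ∨ ∃ y : (ℕ × ℕ) × Bool, (x.1 = y.1 → x.2 = y.2) ∧ BraidImage y M) :
    ∃ N, FreeGroup.IsReduced N ∧ BraidImage x N ∧
      braidAut 0 (FreeGroup.mk [x]) * FreeGroup.mk M = FreeGroup.mk N := by
  rw [braidAut_mk_singleton, FreeGroup.mul_mk]
  obtain ⟨⟨_ | _ | j, q⟩, b⟩ := x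
  · by_cases hM0 : ∃ M', M = ((0, 0), true) :: M'
    · obtain ⟨M', rfl⟩ := hM0
      refine ⟨((0, 0), true) :: ((1, q), b) :: M', ?_, ⟨M', rfl⟩, ?_⟩
      · refine isReduced_cons_iff.2 ⟨by simp, isReduced_cons_iff.2
          ⟨?_, (isReduced_cons_iff.1 hM).2⟩⟩
        obtain h | ⟨⟨⟨_ | _ | j, r⟩, c⟩, hxy, h⟩ := h
        · simp at h
        · obtain ⟨M'', h⟩ := h
          obtain rfl := (List.cons.inj h).2
          simpa using hxy
        · rcases r with _ | r <;> cases c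
          · obtain ⟨M'', h⟩ | ⟨r, c, M'', h⟩ := h <;> simp at h
          · obtain ⟨M'', h, h'⟩ := h
            obtain rfl := (List.cons.inj h).2
            intro y hy hqy
            exact absurd (congrArg Prod.fst hqy).symm (h' y hy)
          · obtain ⟨M'', h⟩ := h
            simp at h
          · obtain ⟨M'', h⟩ := h
            simp at h
        · obtain ⟨M'', h⟩ := h
          simp at h
      · exact (FreeGroup.mul_mk.symm.trans (congrArg
          (FreeGroup.mk [((0, 0), true), ((1, q), b)] * ·)
          (mk_cons_cancel (0, 0) false M'))).trans FreeGroup.mul_mk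
    · refine ⟨((0, 0), true) :: ((1, q), b) :: ((0, 0), false) :: M, ?_, ⟨_, rfl⟩, rfl⟩
      simp only [isReduced_cons_iff]
      refine ⟨by simp, by simp, ?_, hM⟩
      rintro ⟨y, c⟩ hy (rfl : (0, 0) = y)
      cases c
      · rfl
      · exact absurd ⟨M.tail, (List.cons_head?_tail hy).symm⟩ hM0
  · rcases q with _ | q
    · obtain rfl | ⟨⟨⟨_ | _ | j, r⟩, c⟩, hxy, h⟩ := h
      · cases b
        · exact ⟨[((0, 0), false)], .singleton, Or.inl ⟨_, rfl⟩, rfl⟩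
        · exact ⟨[((0, 0), true)], .singleton, ⟨_, rfl, by simp⟩, rfl⟩
      · obtain ⟨M', rfl⟩ := h
        cases b
        · exact ⟨_, (isReduced_cons_iff.1 hM).2, Or.inr ⟨r, c, M', rfl⟩,
            mk_cons_cancel (0, 0) false _⟩
        · exact ⟨((0, 0), true) :: ((0, 0), true) :: ((1, r), c) :: M',
            isReduced_cons_iff.2 ⟨by simp, hM⟩, ⟨_, rfl, by simp⟩, rfl⟩
      · rcases r with _ | r
        · obtain rfl : b = c := hxy rfl
          cases b
          · refine ⟨((0, 0), false) :: M, isReduced_cons_iff.2 ⟨?_, hM⟩, Or.inl ⟨_, rfl⟩, rfl⟩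
            obtain ⟨M', rfl⟩ | ⟨r, c, M', rfl⟩ := h <;> simp
          · obtain ⟨M', rfl, h⟩ := h
            exact ⟨_, isReduced_cons_iff.2 ⟨by simp, hM⟩, ⟨_, rfl, by simp⟩, rfl⟩
        · obtain ⟨M', rfl⟩ := h
          cases b
          · exact ⟨_, isReduced_cons_iff.2 ⟨by simp, hM⟩, Or.inl ⟨_, rfl⟩, rfl⟩
          · exact ⟨_, isReduced_cons_iff.2 ⟨by simp, hM⟩, ⟨_, rfl, by simp⟩, rfl⟩
      · obtain ⟨M', rfl⟩ := h
        cases b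
        · exact ⟨_, isReduced_cons_iff.2 ⟨by simp, hM⟩, Or.inl ⟨_, rfl⟩, rfl⟩
        · exact ⟨_, isReduced_cons_iff.2 ⟨by simp, hM⟩, ⟨_, rfl, by simp⟩, rfl⟩
    · refine ⟨((0, q + 1), b) :: M, isReduced_cons_iff.2 ⟨?_, hM⟩, ⟨_, rfl⟩, rfl⟩
      obtain rfl | ⟨⟨⟨_ | _ | j, r⟩, c⟩, hxy, h⟩ := h
      · simp
      · obtain ⟨M', rfl⟩ := h
        simp
      · rcases r with _ | r
        · cases c
          · obtain ⟨M', rfl⟩ | ⟨r, c, M', rfl⟩ := h <;> simp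
          · obtain ⟨M', rfl, h⟩ := h
            simp
        · obtain ⟨M', rfl⟩ := h
          simpa using hxy
      · obtain ⟨M', rfl⟩ := h
        simp
  · refine ⟨((j + 2, q), b) :: M, isReduced_cons_iff.2 ⟨?_, hM⟩, ⟨_, rfl⟩, rfl⟩
    obtain rfl | ⟨⟨⟨_ | _ | j, r⟩, c⟩, hxy, h⟩ := h
    · simp
    · obtain ⟨M', rfl⟩ := h
      simp
    · rcases r with _ | r
      · cases c
        · obtain ⟨M', rfl⟩ | ⟨r, c, M', rfl⟩ := h <;> simp
        · obtain ⟨M', rfl, h⟩ := h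
          simp
      · obtain ⟨M', rfl⟩ := h
        simp
    · obtain ⟨M', rfl⟩ := h
      simpa using hxy

theorem exists_braidImage {x : (ℕ × ℕ) × Bool} {L : List ((ℕ × ℕ) × Bool)}
    (h : FreeGroup.IsReduced (x :: L)) :
    ∃ M, FreeGroup.IsReduced M ∧ BraidImage x M ∧
      braidAut 0 (FreeGroup.mk (x :: L)) = FreeGroup.mk M := by
  induction L generalizing x with
  | nil =>
    obtain ⟨N, hN, hxN, h⟩ := braidImage_cons (x := x) .nil (Or.inl rfl)
    exact ⟨N, hN, hxN, by rwa [← FreeGroup.one_eq_mk, mul_one] at h⟩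
  | cons y L ih =>
    have hxy := isReduced_cons_iff.1 h
    obtain ⟨M, hM, hyM, hL⟩ := ih hxy.2
    obtain ⟨N, hN, hxN, h⟩ := braidImage_cons hM (Or.inr ⟨y, hxy.1 y rfl, hyM⟩)
    exact ⟨N, hN, hxN, by rw [← h, ← hL, ← map_mul, FreeGroup.mul_mk, List.singleton_append]⟩

theorem StartsWith.braidAut {q : ℕ} {b : Bool} {g : LoopGroup} (h : StartsWith q b g) :
    StartsWith 0 true (braidAut 0 g) := by
  obtain ⟨L, hL, rfl⟩ := h
  obtain ⟨M, hM, ⟨M', rfl⟩, h⟩ := exists_braidImage hL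
  exact ⟨_, hM, h⟩

theorem eq_of_mk_eq {L M : List ((ℕ × ℕ) × Bool)} (hL : FreeGroup.IsReduced L)
    (hM : FreeGroup.IsReduced M) (h : FreeGroup.mk L = FreeGroup.mk M) : L = M := by
  rw [← hL.reduce_eq, ← hM.reduce_eq, ← FreeGroup.toWord_mk, h, FreeGroup.toWord_mk]

/-! ### Positivity of braids -/

/-- The elements admitting an expression in which `σ₁` occurs, but `σ₁⁻¹` and `a₁` do not. -/
inductive SigmaPos (D : Bdot →* Bdot) : Bdot → Prop
  | base (x y : Bdot) : SigmaPos D (D x * σ 0 * D y)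
  | mul {g h : Bdot} : SigmaPos D g → SigmaPos D h → SigmaPos D (g * h)

theorem SigmaPos.shift_mul {D : Bdot →* Bdot} {g : Bdot} (h : SigmaPos D g) (z : Bdot) :
    SigmaPos D (D z * g) := by
  induction h with
  | base x y => simpa only [map_mul, mul_assoc] using SigmaPos.base (D := D) (z * x) y
  | mul _ h₂ ih _ => simpa only [mul_assoc] using ih.mul h₂

theorem SigmaPos.mul_shift {D : Bdot →* Bdot} {g : Bdot} (h : SigmaPos D g) (z : Bdot) :
    SigmaPos D (g * D z) := by
  induction h with
  | base x y => simpa only [map_mul, mul_assoc] using SigmaPos.base (D := D) x (y * z)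
  | mul h₁ _ _ ih => simpa only [mul_assoc] using h₁.mul ih

theorem SigmaPos.startsWith {D : Bdot →* Bdot} (hDσ : ∀ i : ℕ, D (σ i) = σ (i + 1))
    (hDa : ∀ i : ℕ, D (a i) = a (i + 1)) {P : Bdot} (hP : SigmaPos D P) :
    (∀ q g, StartsWith q true g → StartsWith 0 true (artin P g)) ∧
      ∀ q, StartsWith 0 true (artin P (loop 0 q)⁻¹) := by
  induction hP with
  | base x y =>
    have key : ∀ q b g, StartsWith q b g → StartsWith 0 true (artin (D x * σ 0 * D y) g) := by
      intro q b g h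
      rw [map_mul, map_mul, artin_σ]
      exact ((h.artin_shift hDσ hDa y).braidAut).artin_shift hDσ hDa x
    exact ⟨fun q g => key q true g, fun q => key q false _ ⟨[], .singleton, rfl⟩⟩
  | mul _ _ ih₁ ih₂ =>
    simp only [map_mul]
    exact ⟨fun q g h => ih₁.1 _ _ (ih₂.1 q g h), fun q => ih₁.1 _ _ (ih₂.2 q)⟩

theorem SigmaPos.ne_zpow {D : Bdot →* Bdot} (hDσ : ∀ i : ℕ, D (σ i) = σ (i + 1))
    (hDa : ∀ i : ℕ, D (a i) = a (i + 1)) {P : Bdot} (hP : SigmaPos D P) (n : ℤ) :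
    P ≠ a 0 ^ n := by
  rintro rfl
  obtain ⟨p, q, h, -⟩ := exists_artin_zpow_loop n
  obtain ⟨M, hM, h'⟩ := (hP.startsWith hDσ hDa).2 p
  rw [map_inv, h] at h'
  have := eq_of_mk_eq (L := [((0, q), false)]) .singleton hM h'
  simp at this

theorem eq_zero_of_shift_eq_zpow {D : Bdot →* Bdot} (hDσ : ∀ i : ℕ, D (σ i) = σ (i + 1))
    (hDa : ∀ i : ℕ, D (a i) = a (i + 1)) {x : Bdot} {n : ℤ} (h : D x = a 0 ^ n) : n = 0 := by
  obtain ⟨p, q, hpq, hn⟩ := exists_artin_zpow_loop n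
  by_contra hn0
  rw [← h, artin_shift_loop_zero hDσ hDa] at hpq
  exact hn hn0 (congrArg Prod.snd (FreeGroup.of_injective hpq))

/-! ### One-generated left-distributive terms -/

/-- Terms in one variable over a single binary operation. -/
inductive LDTerm : Type
  | var : LDTerm
  | op : LDTerm → LDTerm → LDTerm

namespace LDTerm

/-- One application of left distributivity, in the expanding direction, anywhere in a term. -/
inductive Step : LDTerm → LDTerm → Prop
  | ld (s t u : LDTerm) : Step (op s (op t u)) (op (op s t) (op s u))
  | left {s s' : LDTerm} (t : LDTerm) : Step s s' → Step (op s t) (op s' t)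
  | right (s : LDTerm) {t t' : LDTerm} : Step t t' → Step (op s t) (op s t')

/-- Expansion of terms by left distributivity. -/
abbrev Expand : LDTerm → LDTerm → Prop := Relation.ReflTransGen Step

theorem Expand.op {s s' t t' : LDTerm} (h : Expand s s') (h' : Expand t t') :
    Expand (op s t) (op s' t') :=
  (Relation.ReflTransGen.lift (LDTerm.op · t) (fun _ _ => Step.left t) _ _ h).trans
    (Relation.ReflTransGen.lift (LDTerm.op s') (fun _ _ => Step.right s') _ _ h')

/-- Full distribution of `s` over a term. -/
def dist (s : LDTerm) : LDTerm → LDTerm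
  | var => op s var
  | op t u => op (dist s t) (dist s u)

/-- The fundamental expansion of a term. -/
def full : LDTerm → LDTerm
  | var => var
  | op t u => dist (full t) (full u)

theorem expand_op_dist (s t : LDTerm) : Expand (op s t) (dist s t) := by
  induction t with
  | var => exact .refl
  | op t u ht hu => exact .head (.ld s t u) (ht.op hu)

theorem expand_full (t : LDTerm) : Expand t (full t) := by
  induction t with
  | var => exact .refl
  | op t u ht hu => exact (ht.op hu).trans (expand_op_dist _ _)

theorem Expand.dist_left {s s' : LDTerm} (h : Expand s s') (t : LDTerm) :
    Expand (dist s t) (dist s' t) := by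
  induction t with
  | var => exact h.op .refl
  | op t u ht hu => exact ht.op hu

theorem Step.dist_right (s : LDTerm) {t t' : LDTerm} (h : Step t t') :
    Step (dist s t) (dist s t') := by
  induction h with
  | ld t u v => exact .ld _ _ _
  | left t _ ih => exact .left _ ih
  | right t _ ih => exact .right _ ih

theorem Expand.dist {s s' t t' : LDTerm} (h : Expand s s') (h' : Expand t t') :
    Expand (dist s t) (dist s' t') :=
  (h.dist_left t).trans
    (Relation.ReflTransGen.lift (LDTerm.dist s') (fun _ _ => Step.dist_right s') _ _ h')

theorem expand_dist_dist (s t u : LDTerm) :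
    Expand (dist s (dist t u)) (dist (dist s t) (dist s u)) := by
  induction u with
  | var => exact expand_op_dist (dist s t) (op s var)
  | op u v hu hv => exact hu.op hv

theorem expand_op_op_dist (s t u : LDTerm) :
    Expand (op (dist s t) (op s u)) (dist s (dist t u)) := by
  induction u with
  | var => exact .refl
  | op u v hu hv =>
    exact .head (.right _ (.ld _ _ _)) (.head (.ld _ _ _) (hu.op hv))

theorem Step.expand_full {t t' : LDTerm} (h : Step t t') : Expand t' (full t) := by
  induction h with
  | ld s t u =>
    have h : Expand (op (op s t) (op s u)) (op (dist s.full t.full) (op s.full u.full)) :=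
      Expand.op ((s.expand_full.op t.expand_full).trans (expand_op_dist _ _))
        (s.expand_full.op u.expand_full)
    exact h.trans (expand_op_op_dist _ _ _)
  | left t _ ih => exact (ih.op t.expand_full).trans (expand_op_dist _ _)
  | right t _ ih => exact (t.expand_full.op ih).trans (expand_op_dist _ _)

theorem Step.full {t t' : LDTerm} (h : Step t t') : Expand (full t) (full t') := by
  induction h with
  | ld s t u => exact expand_dist_dist _ _ _
  | left t _ ih => exact ih.dist .refl
  | right t _ ih => exact Expand.dist .refl ih

theorem expand_church_rosser {t u v : LDTerm} (h : Expand t u) (h' : Expand t v) :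
    Relation.Join Expand u v := by
  have key : ∀ {s t}, Expand s t →
      Relation.ReflTransGen (fun s t => Expand s t ∧ Expand t (LDTerm.full s)) s t :=
    fun h => Relation.ReflTransGen.mono (fun _ _ h => ⟨.single h, h.expand_full⟩) _ _ h
  have back : ∀ {s t}, Relation.ReflTransGen
      (fun s t => Expand s t ∧ Expand t (LDTerm.full s)) s t → Expand s t := by
    intro s t h
    induction h with
    | refl => exact .refl
    | tail _ h ih => exact ih.trans h.1
  have full_mono : ∀ {s t}, Expand s t → Expand (LDTerm.full s) (LDTerm.full t) := by
    intro s t h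
    induction h with
    | refl => exact .refl
    | tail _ h ih => exact ih.trans h.full
  obtain ⟨w, hu, hv⟩ := Relation.church_rosser (fun a b c hb hc =>
    ⟨LDTerm.full a, .single ⟨hb.2, full_mono hb.1⟩, .single ⟨hc.2, full_mono hc.1⟩⟩)
    (key h) (key h')
  exact ⟨w, back hu, back hv⟩

theorem join_expand_trans {s t u : LDTerm} (h : Relation.Join Expand s t)
    (h' : Relation.Join Expand t u) : Relation.Join Expand s u :=
  (Relation.equivalence_join fun _ _ _ => expand_church_rosser).trans h h'

theorem join_expand_op {s s' t t' : LDTerm} (h : Relation.Join Expand s s')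
    (h' : Relation.Join Expand t t') : Relation.Join Expand (op s t) (op s' t') := by
  obtain ⟨u, hu, hu'⟩ := h
  obtain ⟨v, hv, hv'⟩ := h'
  exact ⟨op u v, Expand.op hu hv, Expand.op hu' hv'⟩

/-- The right power `x * (x * (⋯ * x))`. -/
def rightPow : ℕ → LDTerm
  | 0 => var
  | n + 1 => op var (rightPow n)

theorem exists_join_op_rightPow (t : LDTerm) :
    ∃ N, ∀ n, N ≤ n → Relation.Join Expand (rightPow (n + 1)) (op t (rightPow n)) := by
  induction t with
  | var => exact ⟨0, fun n _ => ⟨_, .refl, .refl⟩⟩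
  | op t u ht hu =>
    obtain ⟨N₁, h₁⟩ := ht
    obtain ⟨N₂, h₂⟩ := hu
    refine ⟨max N₁ N₂ + 1, fun n hn => ?_⟩
    obtain ⟨n, rfl⟩ := Nat.exists_eq_add_of_le' (Nat.le_of_add_left_le hn)
    have hn₁ : N₁ ≤ n := by omega
    have hn₂ : N₂ ≤ n := by omega
    refine join_expand_trans (h₁ _ (Nat.le_succ_of_le hn₁))
      (join_expand_trans (join_expand_op ⟨t, .refl, .refl⟩ (h₂ n hn₂)) ?_)
    refine join_expand_trans (t := op (op t u) (op t (rightPow n)))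
      ⟨_, .single (.ld _ _ _), .refl⟩ (join_expand_op ⟨_, .refl, .refl⟩ ?_)
    exact Std.Symm.symm _ _ (h₁ n hn₁)

/-- `IsPrefix s t` holds if `s` is an iterated left subterm of `t`. -/
inductive IsPrefix : LDTerm → LDTerm → Prop
  | refl (t : LDTerm) : IsPrefix t t
  | op {s t : LDTerm} (u : LDTerm) : IsPrefix s t → IsPrefix s (op t u)

theorem IsPrefix.total {s s' t : LDTerm} (h : IsPrefix s t) (h' : IsPrefix s' t) :
    IsPrefix s s' ∨ IsPrefix s' s := by
  induction h with
  | refl => exact Or.inr h'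
  | op u h ih =>
    cases h' with
    | refl => exact Or.inl (h.op u)
    | op _ h' => exact ih h'

theorem IsPrefix.step {s t t' : LDTerm} (h : IsPrefix s t) (ht : Step t t') :
    ∃ s', Expand s s' ∧ IsPrefix s' t' := by
  induction h generalizing t' with
  | refl => exact ⟨t', .single ht, .refl t'⟩
  | op u h ih =>
    cases ht with
    | ld _ v w => exact ⟨_, .refl, (h.op v).op _⟩
    | left _ ht =>
      obtain ⟨s', hs, h'⟩ := ih ht
      exact ⟨s', hs, h'.op u⟩
    | right _ _ => exact ⟨_, .refl, h.op _⟩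

theorem IsPrefix.expand {s t t' : LDTerm} (h : IsPrefix s t) (ht : Expand t t') :
    ∃ s', Expand s s' ∧ IsPrefix s' t' := by
  induction ht with
  | refl => exact ⟨s, .refl, h⟩
  | tail _ ht ih =>
    obtain ⟨s', hs, h'⟩ := ih
    obtain ⟨s'', hs', h''⟩ := h'.step ht
    exact ⟨s'', hs.trans hs', h''⟩

theorem exists_expand_isPrefix (t u : LDTerm) :
    ∃ t' u', Expand t t' ∧ Expand u u' ∧ (IsPrefix t' u' ∨ IsPrefix u' t') := by
  obtain ⟨N₁, h₁⟩ := exists_join_op_rightPow t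
  obtain ⟨N₂, h₂⟩ := exists_join_op_rightPow u
  obtain ⟨w, ht, hu⟩ := join_expand_trans (Std.Symm.symm _ _ (h₁ (max N₁ N₂) (le_max_left _ _)))
    (h₂ (max N₁ N₂) (le_max_right _ _))
  obtain ⟨t', ht, ht'⟩ := ((IsPrefix.refl t).op _).expand ht
  obtain ⟨u', hu, hu'⟩ := ((IsPrefix.refl u).op _).expand hu
  exact ⟨t', u', ht, hu, ht'.total hu'⟩

/-- Left-distributive terms as `{*,∘}`-terms. -/
def toTerm1 : LDTerm → Term1
  | var => .var
  | op t u => .star (toTerm1 t) (toTerm1 u)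

theorem Step.aldCong {t t' : LDTerm} (h : Step t t') : ALDCong t.toTerm1 t'.toTerm1 := by
  induction h with
  | ld s t u => exact .LD _ _ _
  | left t _ ih => exact .starCong ih (.refl _)
  | right t _ ih => exact .starCong (.refl _) ih

theorem Expand.aldCong {t t' : LDTerm} (h : Expand t t') : ALDCong t.toTerm1 t'.toTerm1 := by
  induction h with
  | refl => exact .refl _
  | tail _ h ih => exact ih.trans h.aldCong

end LDTerm

/-! ### The brackets on the parenthesized braid group -/

theorem a_mul_shift {D : Bdot →* Bdot} (hDσ : ∀ i : ℕ, D (σ i) = σ (i + 1))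
    (hDa : ∀ i : ℕ, D (a i) = a (i + 1)) (z : Bdot) : a 0 * D z = D (D z) * a 0 := by
  induction z using Bdot.induction with
  | one => simp
  | hσ i => simpa only [hDσ] using a_σ_shift i.succ_pos
  | ha i => simpa only [hDa] using a_a_shift i.succ_pos
  | inv x h =>
    simp only [map_inv]
    exact (eq_inv_mul_iff_mul_eq.2 (by rw [← mul_assoc, ← h, mul_inv_cancel_right]))
  | mul x y hx hy => simp only [map_mul]; rw [← mul_assoc, hx, mul_assoc, hy, mul_assoc]

theorem σ_mul_shift_shift {D : Bdot →* Bdot} (hDσ : ∀ i : ℕ, D (σ i) = σ (i + 1))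
    (hDa : ∀ i : ℕ, D (a i) = a (i + 1)) (z : Bdot) : σ 0 * D (D z) = D (D z) * σ 0 := by
  change Commute _ _
  induction z using Bdot.induction with
  | one => simp
  | hσ i => rw [hDσ, hDσ]; exact (σ_comm (Nat.le_add_left 2 i)).symm
  | ha i => rw [hDa, hDa]; exact (a_σ_far (Nat.le_add_left 2 i)).symm
  | inv x h => simpa only [map_inv] using h.inv_right
  | mul x y hx hy => simpa only [map_mul] using hx.mul_right hy

theorem evalT_eq_of_aldCong {D : Bdot →* Bdot} (hDσ : ∀ i : ℕ, D (σ i) = σ (i + 1))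
    (hDa : ∀ i : ℕ, D (a i) = a (i + 1)) (γ : Bdot) {t t' : Term1} (h : ALDCong t t') :
    evalT D γ t = evalT D γ t' := by
  have hs := σ_mul_shift_shift hDσ hDa
  have ha := a_mul_shift hDσ hDa
  induction h with
  | LD t u v =>
    simp only [evalT, map_mul, map_inv, hDσ, mul_inv_rev, inv_inv]
    generalize evalT D γ t = b, evalT D γ u = c, evalT D γ v = d
    have h : σ 0 * σ 1 * σ 0 * (σ 1)⁻¹ = σ 1 * σ 0 := by
      rw [← σ_braid 0, mul_inv_cancel_right]
    calc b * (D c * D (D d) * σ 1 * (D (D c))⁻¹) * σ 0 * (D b)⁻¹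
      _ = b * D c * D (D d) * σ 1 * ((D (D c))⁻¹ * σ 0) * (D b)⁻¹ := by group
      _ = b * D c * D (D d) * (σ 1 * σ 0) * (D (D c))⁻¹ * (D b)⁻¹ := by
        rw [← map_inv, ← map_inv, ← hs]; group
      _ = b * D c * D (D d) * σ 0 * σ 1 * σ 0 * (σ 1)⁻¹ * (D (D c))⁻¹ * (D b)⁻¹ := by
        rw [← h]; group
      _ = b * D c * (D (D d) * σ 0) * σ 1 * (D (D b))⁻¹ * (D (D b) * σ 0) * (σ 1)⁻¹ *
          (D (D c))⁻¹ * (D b)⁻¹ := by group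
      _ = _ := by rw [← hs, ← hs]; group
  | ALD1 t u v =>
    simp only [evalT, map_mul, map_inv, hDσ, hDa, mul_inv_rev]
    generalize evalT D γ t = b, evalT D γ u = c, evalT D γ v = d
    have h : a 0 * σ 0 * (a 1)⁻¹ = σ 1 * σ 0 := by
      rw [← σ_σ_a_succ 0, mul_inv_cancel_right]
    calc b * D c * a 0 * D d * σ 0 * ((a (0 + 1))⁻¹ * ((D (D c))⁻¹ * (D b)⁻¹))
      _ = b * D c * (a 0 * D d) * σ 0 * (a 1)⁻¹ * (D (D c))⁻¹ * (D b)⁻¹ := by group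
      _ = b * D c * D (D d) * (a 0 * σ 0 * (a 1)⁻¹) * (D (D c))⁻¹ * (D b)⁻¹ := by
        rw [ha]; group
      _ = b * D c * D (D d) * σ 1 * (σ 0 * D (D c⁻¹)) * (D b)⁻¹ := by
        rw [h, map_inv, map_inv]; group
      _ = _ := by rw [hs, map_inv, map_inv]; group
  | ALD2 t u v =>
    simp only [evalT, map_mul, map_inv, hDσ, hDa]
    generalize evalT D γ t = b, evalT D γ u = c, evalT D γ v = d
    calc b * (D c * D (D d) * a 1) * σ 0 * (D b)⁻¹
      _ = b * D c * D (D d) * (a 1 * σ 0) * (D b)⁻¹ := by group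
      _ = b * D c * (D (D d) * σ 0) * σ 1 * (a 0 * D b⁻¹) := by
        rw [← σ_σ_a 0, map_inv]; group
      _ = _ := by rw [ha, ← hs, map_inv, map_inv]; group
  | refl => rfl
  | symm _ ih => exact ih.symm
  | trans _ _ ih₁ ih₂ => exact ih₁.trans ih₂
  | starCong _ _ ih₁ ih₂ => simp only [evalT, ih₁, ih₂]
  | circCong _ _ ih₁ ih₂ => simp only [evalT, ih₁, ih₂]

theorem LDTerm.IsPrefix.evalT {s t : LDTerm} (h : IsPrefix s t) (D : Bdot →* Bdot) (γ : Bdot) :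
    s = t ∨ ∃ P, SigmaPos D P ∧
      ParenBraid.evalT D γ t.toTerm1 = ParenBraid.evalT D γ s.toTerm1 * P := by
  induction h with
  | refl => exact Or.inl rfl
  | @op t u h ih =>
    have hP := SigmaPos.base (D := D) (ParenBraid.evalT D γ u.toTerm1)
      (ParenBraid.evalT D γ t.toTerm1)⁻¹
    obtain rfl | ⟨P, hP', h⟩ := ih
    · exact Or.inr ⟨_, hP, by simp only [toTerm1, ParenBraid.evalT, map_inv, mul_assoc]⟩
    · refine Or.inr ⟨_, hP'.mul hP, ?_⟩
      simp only [toTerm1, ParenBraid.evalT, map_inv, mul_assoc]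
      rw [h, mul_assoc]

theorem aldCong_or_evalT_eq_mul {D : Bdot →* Bdot} (hDσ : ∀ i : ℕ, D (σ i) = σ (i + 1))
    (hDa : ∀ i : ℕ, D (a i) = a (i + 1)) (γ : Bdot) (t u : LDTerm) :
    ALDCong t.toTerm1 u.toTerm1 ∨ ∃ P, SigmaPos D P ∧
      (evalT D γ u.toTerm1 = evalT D γ t.toTerm1 * P ∨
        evalT D γ t.toTerm1 = evalT D γ u.toTerm1 * P) := by
  obtain ⟨t', u', ht, hu, h⟩ := LDTerm.exists_expand_isPrefix t u
  have ht := LDTerm.Expand.aldCong ht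
  have hu := LDTerm.Expand.aldCong hu
  rw [evalT_eq_of_aldCong hDσ hDa γ ht, evalT_eq_of_aldCong hDσ hDa γ hu]
  obtain h | h := h <;> obtain rfl | ⟨P, hP, h⟩ := h.evalT D γ
  · exact Or.inl (ht.trans hu.symm)
  · exact Or.inr ⟨P, hP, Or.inl h⟩
  · exact Or.inl (ht.trans hu.symm)
  · exact Or.inr ⟨P, hP, Or.inr h⟩

/-! ### Binary trees of left-distributive terms -/

/-- Binary trees with leaves labelled by left-distributive terms: normal forms of terms under
the augmented left-distributive laws. -/
inductive LDTree : Type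
  | leaf : LDTerm → LDTree
  | node : LDTree → LDTree → LDTree

namespace LDTree

/-- The `{*,∘}`-term represented by a tree. -/
def toTerm1 : LDTree → Term1
  | leaf l => l.toTerm1
  | node T U => .circ (toTerm1 T) (toTerm1 U)

/-- The number of leaves of a tree. -/
def size : LDTree → ℕ
  | leaf _ => 1
  | node T U => size T + size U

theorem exists_aldCong_star (T U : LDTree) :
    ∃ V : LDTree, ALDCong (.star T.toTerm1 U.toTerm1) V.toTerm1 := by
  induction T generalizing U with
  | leaf l =>
    induction U with
    | leaf m => exact ⟨leaf (l.op m), .refl _⟩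
    | node U₁ U₂ ih₁ ih₂ =>
      obtain ⟨V₁, h₁⟩ := ih₁
      obtain ⟨V₂, h₂⟩ := ih₂
      exact ⟨node V₁ V₂, (ALDCong.ALD2 _ _ _).trans (h₁.circCong h₂)⟩
  | node T₁ T₂ ih₁ ih₂ =>
    obtain ⟨V, h⟩ := ih₂ U
    obtain ⟨W, h'⟩ := ih₁ V
    exact ⟨W, ((ALDCong.ALD1 _ _ _).trans (.starCong (.refl _) h)).trans h'⟩

theorem exists_aldCong (t : Term1) : ∃ T : LDTree, ALDCong t T.toTerm1 := by
  induction t with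
  | var => exact ⟨leaf .var, .refl _⟩
  | star t u ht hu =>
    obtain ⟨T, hT⟩ := ht
    obtain ⟨U, hU⟩ := hu
    obtain ⟨V, hV⟩ := exists_aldCong_star T U
    exact ⟨V, (hT.starCong hU).trans hV⟩
  | circ t u ht hu =>
    obtain ⟨T, hT⟩ := ht
    obtain ⟨U, hU⟩ := hu
    exact ⟨node T U, hT.circCong hU⟩

theorem exists_eq_foldl (T : LDTree) : ∃ l L, T = List.foldl node (leaf l) L := by
  induction T with
  | leaf l => exact ⟨l, [], rfl⟩
  | node T U ih _ =>
    obtain ⟨l, L, rfl⟩ := ih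
    exact ⟨l, L ++ [U], by rw [List.foldl_append, List.foldl_cons, List.foldl_nil]⟩

theorem size_foldl (T : LDTree) (L : List LDTree) :
    (L.foldl node T).size = T.size + (L.map size).sum := by
  induction L generalizing T with
  | nil => rfl
  | cons U L ih => simp [ih, size, add_assoc]

theorem aldCong_foldl {T T' : LDTree} (h : ALDCong T.toTerm1 T'.toTerm1) {L L' : List LDTree}
    (hL : List.Forall₂ (fun U U' => ALDCong U.toTerm1 U'.toTerm1) L L') :
    ALDCong (L.foldl node T).toTerm1 (L'.foldl node T').toTerm1 := by
  induction hL generalizing T T' with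
  | nil => exact h
  | cons hU _ ih => exact ih (h.circCong hU)

/-- Evaluation of a sequence of trees, placed on consecutive positions. -/
def evalForest (D : Bdot →* Bdot) (γ : Bdot) : List LDTree → Bdot
  | [] => 1
  | T :: F => evalT D γ T.toTerm1 * D (evalForest D γ F)

theorem evalT_foldl {D : Bdot →* Bdot} (hDσ : ∀ i : ℕ, D (σ i) = σ (i + 1))
    (hDa : ∀ i : ℕ, D (a i) = a (i + 1)) (γ : Bdot) (T : LDTree) (L : List LDTree) :
    evalT D γ (L.foldl node T).toTerm1 =
      evalT D γ T.toTerm1 * D (evalForest D γ L) * a 0 ^ L.length := by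
  induction L generalizing T with
  | nil => simp [evalForest]
  | cons U L ih =>
    rw [List.foldl_cons, ih, List.length_cons, pow_succ']
    simp only [toTerm1, evalT, evalForest, map_mul, mul_assoc]
    rw [← mul_assoc (a 0), a_mul_shift hDσ hDa, mul_assoc]

theorem shift_evalForest_append {D : Bdot →* Bdot} (hDσ : ∀ i : ℕ, D (σ i) = σ (i + 1))
    (hDa : ∀ i : ℕ, D (a i) = a (i + 1)) (γ : Bdot) (L F : List LDTree) :
    D (evalForest D γ (L ++ F)) * a 0 ^ L.length =
      D (evalForest D γ L) * a 0 ^ L.length * D (evalForest D γ F) := by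
  induction L with
  | nil => simp [evalForest]
  | cons U L ih =>
    have ha := a_mul_shift hDσ hDa
    simp only [List.cons_append, evalForest, map_mul, List.length_cons, pow_succ']
    rw [mul_assoc, ← mul_assoc (D (D _)), ← ha, mul_assoc (a 0), ih,
      mul_assoc (D (evalT D γ U.toTerm1)) (D (D _)), ← mul_assoc (D (D _)), ← ha]
    simp only [mul_assoc]

theorem evalForest_foldl_cons {D : Bdot →* Bdot} (hDσ : ∀ i : ℕ, D (σ i) = σ (i + 1))
    (hDa : ∀ i : ℕ, D (a i) = a (i + 1)) (γ : Bdot) (l : LDTerm) (L F : List LDTree) :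
    evalForest D γ (L.foldl node (leaf l) :: F) =
      evalT D γ l.toTerm1 * D (evalForest D γ (L ++ F)) * a 0 ^ L.length := by
  rw [mul_assoc, shift_evalForest_append hDσ hDa, evalForest, evalT_foldl hDσ hDa]
  simp only [mul_assoc, toTerm1]

end LDTree

theorem shift_mul_pow_injective {D : Bdot →* Bdot} (hDσ : ∀ i : ℕ, D (σ i) = σ (i + 1))
    (hDa : ∀ i : ℕ, D (a i) = a (i + 1)) {x y : Bdot} {m n : ℕ}
    (h : D x * a 0 ^ m = D y * a 0 ^ n) : x = y ∧ m = n := by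
  have h' : D (y⁻¹ * x) = a 0 ^ ((n : ℤ) - m) := by
    rw [map_mul, map_inv, zpow_sub, zpow_natCast, zpow_natCast, eq_mul_inv_iff_mul_eq, mul_assoc, h,
      inv_mul_cancel_left]
  obtain rfl : n = m := by
    have := eq_zero_of_shift_eq_zpow hDσ hDa h'
    omega
  exact ⟨shift_injective hDσ hDa (mul_right_cancel h), rfl⟩

theorem shift_mul_pow_ne {D : Bdot →* Bdot} (hDσ : ∀ i : ℕ, D (σ i) = σ (i + 1))
    (hDa : ∀ i : ℕ, D (a i) = a (i + 1)) {P : Bdot} (hP : SigmaPos D P) (x y : Bdot) (m n : ℕ) :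
    D x * a 0 ^ m ≠ P * D y * a 0 ^ n := by
  intro h
  refine ((hP.mul_shift y).shift_mul x⁻¹).ne_zpow hDσ hDa ((m : ℤ) - n) ?_
  rw [zpow_sub, zpow_natCast, zpow_natCast, eq_mul_inv_iff_mul_eq, mul_assoc, ← h, map_inv,
    inv_mul_cancel_left]

theorem aldCong_and_eq_of_evalT_mul_eq {D : Bdot →* Bdot} (hDσ : ∀ i : ℕ, D (σ i) = σ (i + 1))
    (hDa : ∀ i : ℕ, D (a i) = a (i + 1)) (γ : Bdot) {l l' : LDTerm} {x y : Bdot} {m n : ℕ}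
    (h : evalT D γ l.toTerm1 * D x * a 0 ^ m = evalT D γ l'.toTerm1 * D y * a 0 ^ n) :
    ALDCong l.toTerm1 l'.toTerm1 ∧ x = y ∧ m = n := by
  obtain hl | ⟨P, hP, hl | hl⟩ := aldCong_or_evalT_eq_mul hDσ hDa γ l l'
  · rw [evalT_eq_of_aldCong hDσ hDa γ hl, mul_assoc, mul_assoc] at h
    exact ⟨hl, shift_mul_pow_injective hDσ hDa (mul_left_cancel h)⟩
  · rw [hl] at h
    simp only [mul_assoc] at h
    exact absurd (by simpa only [mul_assoc] using mul_left_cancel h)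
      (shift_mul_pow_ne hDσ hDa hP x y m n)
  · rw [hl] at h
    simp only [mul_assoc] at h
    exact absurd (by simpa only [mul_assoc] using (mul_left_cancel h).symm)
      (shift_mul_pow_ne hDσ hDa hP y x n m)

theorem forall₂_aldCong_of_evalForest_eq {D : Bdot →* Bdot}
    (hDσ : ∀ i : ℕ, D (σ i) = σ (i + 1)) (hDa : ∀ i : ℕ, D (a i) = a (i + 1)) (γ : Bdot)
    {F F' : List LDTree} (hlen : F.length = F'.length)
    (h : LDTree.evalForest D γ F = LDTree.evalForest D γ F') :
    List.Forall₂ (fun T T' => ALDCong T.toTerm1 T'.toTerm1) F F' := by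
  induction hn : (F.map LDTree.size).sum using Nat.strong_induction_on generalizing F F' with
  | _ n ih =>
    match F, F', hlen with
    | [], [], _ => exact .nil
    | T :: F, T' :: F', hlen =>
      obtain ⟨l, L, rfl⟩ := T.exists_eq_foldl
      obtain ⟨l', L', rfl⟩ := T'.exists_eq_foldl
      simp only [LDTree.evalForest_foldl_cons hDσ hDa] at h
      obtain ⟨hl, hLF, hL⟩ := aldCong_and_eq_of_evalT_mul_eq hDσ hDa γ h
      simp only [List.map_cons, List.sum_cons, LDTree.size_foldl, LDTree.size] at hn
      have := ih ((L ++ F).map LDTree.size).sum (by simp; omega) (by simp_all) hLF rfl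
      refine .cons (LDTree.aldCong_foldl (T := .leaf l) (T' := .leaf l') hl ?_) ?_
      · simpa [hL] using List.forall₂_take L.length this
      · simpa [hL] using List.forall₂_drop L.length this

/-- for every `γ ∈ B_•`, if two one-variable `{*,∘}`-terms evaluate at `γ`
to the same element of `B_•`, then they are ALD-equivalent; i.e., the closure of `{γ}`
under `*` and `∘` is a free ALD-system based on `{γ}`. -/
theorem Bdot_free_ALD (D : Bdot →* Bdot)
    (hDσ : ∀ i : ℕ, D (σ i) = σ (i + 1)) (hDa : ∀ i : ℕ, D (a i) = a (i + 1))
    (γ : Bdot) (t t' : Term1) (h : evalT D γ t = evalT D γ t') :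
    ALDCong t t' := by
  obtain ⟨T, hT⟩ := LDTree.exists_aldCong t
  obtain ⟨T', hT'⟩ := LDTree.exists_aldCong t'
  rw [evalT_eq_of_aldCong hDσ hDa γ hT, evalT_eq_of_aldCong hDσ hDa γ hT'] at h
  have := forall₂_aldCong_of_evalForest_eq hDσ hDa γ (F := [T]) (F' := [T']) rfl
    (by simp only [LDTree.evalForest, h])
  exact (hT.trans (List.forall₂_cons.1 this).1).trans hT'.symm

end ParenBraid
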